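/- Approximation of Q-balls by ℓ₂-enlargements of Z-balls (inclusion (C.4) in the proof of Lemma C.1): Let p ∈ [1,2] and α, τ > 0. Then for all ε, R > 0, R^{p/2}B_{Q_{α,τ}} ⊆ εB_{ℓ₂} + aB_{Z_{α,τ}}, where a = a(ε,R) = R^{p/2 + (2−p)/(2(1+2α))} · τ^{(2−p)/(p(1+2α))} · ε^{(p−2)/(p(1+2α))}. -/

import Mathlib

noncomputable section

open Pointwise

/-- The index `ℓ = i + 1 ≥ 1` associated to the coordinate `i : ℕ`. -/
def idx (i : ℕ) : ℝ := (i : ℝ) + 1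

/-- The centered `ℓ₂`-ball of radius `r` in the sequence space `ℝ^ℕ`. -/
def ballL2 (r : ℝ) : Set (ℕ → ℝ) :=
  {h | Summable (fun i => h i ^ 2) ∧ Real.sqrt (∑' i, h i ^ 2) ≤ r}

/-- The centered ball of radius `r` in `Q_{α,τ}`,
`‖h‖_{Q_{α,τ}} = τ⁻¹ (Σ_ℓ ℓ^{1+2α} h_ℓ²)^{1/2}`. -/
def ballQ (α τ r : ℝ) : Set (ℕ → ℝ) :=
  {h | Summable (fun i => idx i ^ (1 + 2 * α) * h i ^ 2) ∧
    τ⁻¹ * Real.sqrt (∑' i, idx i ^ (1 + 2 * α) * h i ^ 2) ≤ r}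

/-- The centered ball of radius `r` in `Z_{α,τ}`,
`‖h‖_{Z_{α,τ}} = τ⁻¹ (Σ_ℓ ℓ^{p/2+αp} |h_ℓ|^p)^{1/p}`. -/
def ballZ (p α τ r : ℝ) : Set (ℕ → ℝ) :=
  {h | Summable (fun i => idx i ^ (p / 2 + α * p) * |h i| ^ p) ∧
    τ⁻¹ * (∑' i, idx i ^ (p / 2 + α * p) * |h i| ^ p) ^ (1 / p) ≤ r}

/-- The cutoff frequency balancing the `ℓ₂` and `Z` parts of the truncation. -/
def cutoff (α B ε : ℝ) : ℝ := (B / ε) ^ (2 / (1 + 2 * α))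

lemma idx_pos (i : ℕ) : 0 < idx i := by unfold idx; positivity

lemma cutoff_nonneg {α B ε : ℝ} (hB : 0 < B) (hε : 0 < ε) : 0 ≤ cutoff α B ε := by
  unfold cutoff; positivity

lemma cutoff_rpow {α B ε : ℝ} (hα : 0 < α) (hB : 0 < B) (hε : 0 < ε) :
    cutoff α B ε ^ (1 + 2 * α) = (B / ε) ^ 2 := by
  have h : 1 + 2 * α ≠ 0 := by positivity
  rw [cutoff, ← Real.rpow_mul (by positivity), div_mul_cancel₀ _ h, Real.rpow_two]

lemma weight_rpow (p α x : ℝ) (i : ℕ) :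
    (idx i ^ (1 / 2 + α) * |x|) ^ p = idx i ^ (p / 2 + α * p) * |x| ^ p := by
  have h := (idx_pos i).le
  rw [Real.mul_rpow (by positivity) (abs_nonneg x), ← Real.rpow_mul h]
  ring_nf

lemma weight_sq (α x : ℝ) (i : ℕ) :
    (idx i ^ (1 / 2 + α) * |x|) ^ (2 : ℝ) = idx i ^ (1 + 2 * α) * x ^ 2 := by
  rw [weight_rpow, Real.rpow_two, sq_abs]
  ring_nf

/-- Comparison of `ℓ_p` and `ℓ₂` norms on a finite set, for `p ≤ 2`. -/
lemma sum_rpow_le_card_mul_sqrt {ι : Type*} (s : Finset ι) {p : ℝ} (hp : 0 < p) (hp2 : p ≤ 2)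
    (w : ι → ℝ) (hw : ∀ i, 0 ≤ w i) :
    (∑ i ∈ s, w i ^ p) ^ (1 / p) ≤
      (s.card : ℝ) ^ (1 / p - 1 / 2) * √(∑ i ∈ s, w i ^ (2 : ℝ)) := by
  have hq : 1 ≤ 2 / p := by rwa [one_le_div hp]
  have key := Real.rpow_sum_le_const_mul_sum_rpow s (fun i => w i ^ p) hq
  have habs : ∀ i, |w i ^ p| = w i ^ p := fun i => abs_of_nonneg (Real.rpow_nonneg (hw i) p)
  have hpow : ∀ i, (w i ^ p) ^ (2 / p) = w i ^ (2 : ℝ) := fun i => by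
    rw [← Real.rpow_mul (hw i), mul_div_cancel₀ _ hp.ne']
  simp only [habs, hpow] at key
  have hsum : 0 ≤ ∑ i ∈ s, w i ^ p := Finset.sum_nonneg fun i _ => Real.rpow_nonneg (hw i) p
  have hcard : (0 : ℝ) ≤ s.card := Nat.cast_nonneg _
  calc (∑ i ∈ s, w i ^ p) ^ (1 / p)
      = ((∑ i ∈ s, w i ^ p) ^ (2 / p)) ^ (1 / 2 : ℝ) := by
        rw [← Real.rpow_mul hsum]; ring_nf
    _ ≤ ((s.card : ℝ) ^ (2 / p - 1) * ∑ i ∈ s, w i ^ (2 : ℝ)) ^ (1 / 2 : ℝ) := by gcongr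
    _ = _ := by
        rw [Real.mul_rpow (by positivity)
          (Finset.sum_nonneg fun i _ => Real.rpow_nonneg (hw i) 2), ← Real.rpow_mul hcard,
          Real.sqrt_eq_rpow]
        ring_nf

/-- High frequencies of an element of a `Q`-ball have small `ℓ₂` norm. -/
lemma tail_mem_ballL2 {α B ε : ℝ} (hα : 0 < α) (hB : 0 < B) (hε : 0 < ε) {h : ℕ → ℝ}
    (hs : Summable fun i => idx i ^ (1 + 2 * α) * h i ^ 2)
    (hB2 : √(∑' i, idx i ^ (1 + 2 * α) * h i ^ 2) ≤ B) :
    (fun i => if i < ⌊cutoff α B ε⌋₊ then 0 else h i) ∈ ballL2 ε := by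
  have hle : ∀ i, (if i < ⌊cutoff α B ε⌋₊ then 0 else h i) ^ 2 ≤
      (ε / B) ^ 2 * (idx i ^ (1 + 2 * α) * h i ^ 2) := by
    intro i
    have hi := idx_pos i
    split_ifs with hlt
    · rw [zero_pow two_ne_zero]; positivity
    · have hc : cutoff α B ε ≤ idx i := by
        have h1 := Nat.lt_floor_add_one (cutoff α B ε)
        have h2 : (⌊cutoff α B ε⌋₊ : ℝ) ≤ i := by exact_mod_cast not_lt.1 hlt
        unfold idx; linarith
      have hpow : (B / ε) ^ 2 ≤ idx i ^ (1 + 2 * α) := by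
        rw [← cutoff_rpow hα hB hε]
        exact Real.rpow_le_rpow (cutoff_nonneg hB hε) hc (by positivity)
      calc h i ^ 2 = (ε / B) ^ 2 * ((B / ε) ^ 2 * h i ^ 2) := by field_simp
        _ ≤ _ := by gcongr
  have hs' := hs.mul_left ((ε / B) ^ 2)
  have hsum := Summable.of_nonneg_of_le (fun i => sq_nonneg _) hle hs'
  refine ⟨hsum, Real.sqrt_le_iff.2 ⟨hε.le, ?_⟩⟩
  calc _ ≤ ∑' i, (ε / B) ^ 2 * (idx i ^ (1 + 2 * α) * h i ^ 2) := hsum.tsum_le_tsum hle hs'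
    _ = (ε / B) ^ 2 * ∑' i, idx i ^ (1 + 2 * α) * h i ^ 2 := tsum_mul_left
    _ ≤ (ε / B) ^ 2 * B ^ 2 := by gcongr; exact (Real.sqrt_le_iff.1 hB2).2
    _ = ε ^ 2 := by field_simp

/-- Low frequencies of an element of a `Q`-ball have controlled `Z` norm. -/
lemma head_mem_ballZ {p α τ B L : ℝ} (hp : 0 < p) (hp2 : p ≤ 2) (hτ : 0 < τ) (hL : 0 ≤ L)
    {h : ℕ → ℝ} (hs : Summable fun i => idx i ^ (1 + 2 * α) * h i ^ 2)
    (hB : √(∑' i, idx i ^ (1 + 2 * α) * h i ^ 2) ≤ B) :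
    (fun i => if i < ⌊L⌋₊ then h i else 0) ∈ ballZ p α τ (τ⁻¹ * (L ^ (1 / p - 1 / 2) * B)) := by
  have hzero : ∀ i ∉ Finset.range ⌊L⌋₊,
      idx i ^ (p / 2 + α * p) * |if i < ⌊L⌋₊ then h i else 0| ^ p = 0 := by
    intro i hi
    rw [if_neg (by simpa using hi), abs_zero, Real.zero_rpow hp.ne', mul_zero]
  refine ⟨summable_of_ne_finset_zero hzero, ?_⟩
  rw [tsum_eq_sum hzero]
  have heq : ∑ i ∈ Finset.range ⌊L⌋₊, idx i ^ (p / 2 + α * p) * |if i < ⌊L⌋₊ then h i else 0| ^ p =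
      ∑ i ∈ Finset.range ⌊L⌋₊, (idx i ^ (1 / 2 + α) * |h i|) ^ p :=
    Finset.sum_congr rfl fun i hi => by rw [if_pos (Finset.mem_range.1 hi), weight_rpow]
  rw [heq]
  have hexp : 0 ≤ 1 / p - 1 / 2 := sub_nonneg.2 (one_div_le_one_div_of_le hp hp2)
  have hsum : ∑ i ∈ Finset.range ⌊L⌋₊, idx i ^ (1 + 2 * α) * h i ^ 2 ≤
      ∑' i, idx i ^ (1 + 2 * α) * h i ^ 2 :=
    hs.sum_le_tsum _ fun i _ => by have := idx_pos i; positivity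
  gcongr
  refine (sum_rpow_le_card_mul_sqrt _ hp hp2 _ fun i => ?_).trans ?_
  · have := idx_pos i; positivity
  · simp only [weight_sq, Finset.card_range]
    gcongr
    · exact Nat.floor_le hL
    · exact (Real.sqrt_le_sqrt hsum).trans hB

lemma radius_eq {p α τ ε R : ℝ} (hp : 0 < p) (hα : 0 < α) (hτ : 0 < τ) (hε : 0 < ε) (hR : 0 < R) :
    τ⁻¹ * (cutoff α (τ * R ^ (p / 2)) ε ^ (1 / p - 1 / 2) * (τ * R ^ (p / 2))) =
      R ^ (p / 2 + (2 - p) / (2 * (1 + 2 * α))) *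
        τ ^ ((2 - p) / (p * (1 + 2 * α))) * ε ^ ((p - 2) / (p * (1 + 2 * α))) := by
  have hα' : 1 + 2 * α ≠ 0 := by positivity
  have e1 : 2 / (1 + 2 * α) * (1 / p - 1 / 2) = (2 - p) / (p * (1 + 2 * α)) := by
    field_simp
  have e2 : p / 2 * ((2 - p) / (p * (1 + 2 * α))) = (2 - p) / (2 * (1 + 2 * α)) := by
    field_simp
  have e3 : (p - 2) / (p * (1 + 2 * α)) = -((2 - p) / (p * (1 + 2 * α))) := by
    rw [← neg_div, neg_sub]
  rw [cutoff, ← Real.rpow_mul (by positivity), e1, e3, Real.div_rpow (by positivity) hε.le,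
    Real.mul_rpow hτ.le (by positivity), ← Real.rpow_mul hR.le, e2, Real.rpow_add hR,
    Real.rpow_neg hε.le]
  field_simp

/-- **Inclusion (C.4)** in the proof of Lemma C.1: balls of `Q_{α,τ}` are contained in
`ℓ₂`-enlargements of suitable balls of `Z_{α,τ}`. -/
theorem qball_subset_l2_add_zball
    (p : ℝ) (hp : p ∈ Set.Icc (1 : ℝ) 2)
    (α τ : ℝ) (hα : 0 < α) (hτ : 0 < τ)
    (ε R : ℝ) (hε : 0 < ε) (hR : 0 < R) :
    ballQ α τ (R ^ (p / 2)) ⊆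
      ballL2 ε +
        ballZ p α τ
          (R ^ (p / 2 + (2 - p) / (2 * (1 + 2 * α))) *
            τ ^ ((2 - p) / (p * (1 + 2 * α))) * ε ^ ((p - 2) / (p * (1 + 2 * α)))) := by
  rintro h ⟨hs, hle⟩
  have hp0 : 0 < p := one_pos.trans_le hp.1
  have hB : 0 < τ * R ^ (p / 2) := by positivity
  have hle' : √(∑' i, idx i ^ (1 + 2 * α) * h i ^ 2) ≤ τ * R ^ (p / 2) :=
    (inv_mul_le_iff₀ hτ).1 hle
  rw [← radius_eq hp0 hα hτ hε hR]
  refine ⟨_, tail_mem_ballL2 hα hB hε hs hle', _,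
    head_mem_ballZ hp0 hp.2 hτ (cutoff_nonneg hB hε) hs hle', ?_⟩
  funext i
  by_cases hi : i < ⌊cutoff α (τ * R ^ (p / 2)) ε⌋₊ <;> simp [hi]
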